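/- Let d ≥ 1. There is no finite family of at least two pairwise disjoint cosets of pairwise distinct Cartesian subgroups of ℤ^d whose union is all of ℤ^d. -/

import Mathlib

noncomputable def cosetTerm (z : ℂ) (m : ℕ) (r x : ℤ) : ℂ :=
  open Classical in if (m : ℤ) ∣ x - r then z ^ x else 0

lemma sum_shift (N : ℕ) (f : ℤ → ℂ) (hf : ∀ x, f (x + N) = f x) (m : ℕ) :
    ∑ x ∈ Finset.range N, f ((x : ℤ) + m) = ∑ x ∈ Finset.range N, f (x : ℤ) := by
  induction m with
  | zero => simp
  | succ m ih =>
    rw [← ih]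
    have h1 := Finset.sum_range_succ (fun x : ℕ => f ((x : ℤ) + m)) N
    have h2 := Finset.sum_range_succ' (fun x : ℕ => f ((x : ℤ) + m)) N
    have h3 : f ((N : ℤ) + m) = f (((0 : ℕ) : ℤ) + m) := by
      rw [add_comm, hf]; simp
    rw [h1, h3] at h2
    have h4 := add_right_cancel h2
    rw [h4]
    refine Finset.sum_congr rfl fun x _ => ?_
    congr 1
    push_cast
    ring

lemma cosetTerm_sum_zero (N a m : ℕ) (r : ℤ) (z : ℂ) (hz : IsPrimitiveRoot z a) (ha : 0 < a)
    (haN : a ∣ N) (hmN : m ∣ N) (ham : ¬ a ∣ m) :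
    ∑ x ∈ Finset.range N, cosetTerm z m r (x : ℤ) = 0 := by
  have hz0 : z ≠ 0 := hz.ne_zero ha.ne'
  have hs := sum_shift N (cosetTerm z m r) (by
    intro x
    have hN : z ^ N = 1 := (hz.pow_eq_one_iff_dvd N).2 haN
    have h1 : ((m : ℤ) ∣ x + N - r) ↔ (m : ℤ) ∣ x - r := by
      rw [show x + (N : ℤ) - r = (x - r) + N by ring]
      exact dvd_add_left (by exact_mod_cast hmN)
    simp only [cosetTerm, h1, zpow_add₀ hz0, zpow_natCast, hN, mul_one]) m
  have h2 : ∀ x : ℤ, cosetTerm z m r (x + m) = z ^ m * cosetTerm z m r x := by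
    intro x
    have h1 : ((m : ℤ) ∣ x + m - r) ↔ (m : ℤ) ∣ x - r := by
      rw [show x + (m : ℤ) - r = (x - r) + m by ring]
      exact dvd_add_left dvd_rfl
    simp only [cosetTerm, h1, zpow_add₀ hz0, zpow_natCast]
    split_ifs
    · ring
    · simp
  simp only [h2, ← Finset.mul_sum] at hs
  have hm : z ^ m ≠ 1 := fun h => ham ((hz.pow_eq_one_iff_dvd m).1 h)
  by_contra h0
  exact hm (mul_right_cancel₀ h0 (by rw [hs, one_mul]))

lemma cosetTerm_sum_ne_zero (N a : ℕ) (r : ℤ) (z : ℂ) (hz : IsPrimitiveRoot z a) (ha : 0 < a)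
    (haN : a ∣ N) (hN : 0 < N) :
    ∑ x ∈ Finset.range N, cosetTerm z a r (x : ℤ) ≠ 0 := by
  classical
  have hz0 : z ≠ 0 := hz.ne_zero ha.ne'
  have h1 : ∀ x : ℤ, cosetTerm z a r x = if (a : ℤ) ∣ x - r then z ^ r else 0 := by
    intro x
    simp only [cosetTerm]
    split_ifs with h
    · have := (hz.zpow_eq_one_iff_dvd _).2 h
      rw [show x = (x - r) + r by ring, zpow_add₀ hz0, this, one_mul]
    · rfl
  simp only [h1]
  rw [← Finset.sum_filter, Finset.sum_const, nsmul_eq_mul]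
  refine mul_ne_zero ?_ (zpow_ne_zero _ hz0)
  rw [Nat.cast_ne_zero, Finset.card_ne_zero]
  have hN' : (0 : ℤ) < N := by exact_mod_cast hN
  have e1 := Int.emod_nonneg r hN'.ne'
  have e2 := Int.emod_lt_of_pos r hN'
  refine ⟨(r % N).toNat, ?_⟩
  rw [Finset.mem_filter, Finset.mem_range, Int.toNat_of_nonneg e1]
  refine ⟨by omega, ?_⟩
  have h3 : (N : ℤ) ∣ r % N - r := by
    rw [← dvd_neg, neg_sub]; exact Int.dvd_self_sub_emod
  exact dvd_trans (by exact_mod_cast haN) h3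

/-- **Generalized Mirsky–Newman theorem**. For `d ≥ 1`, there is no finite
family of at least two pairwise disjoint cosets of pairwise *distinct*
Cartesian subgroups of `ℤ^d` whose union is all of `ℤ^d`. -/
theorem no_tiling_by_distinct_cartesian_subgroups
    (d : ℕ) (hd : 1 ≤ d) :
    ¬ ∃ (k : ℕ) (_ : 2 ≤ k) (v : Fin k → (Fin d → ℤ)) (n : Fin k → Fin d → ℕ),
      (∀ j i, 0 < n j i) ∧
      (∀ j j' : Fin k, j ≠ j' →
        {w : Fin d → ℤ | ∀ i, (n j i : ℤ) ∣ w i} ≠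
          {w : Fin d → ℤ | ∀ i, (n j' i : ℤ) ∣ w i}) ∧
      (∀ j j' : Fin k, j ≠ j' →
        Disjoint {w : Fin d → ℤ | ∀ i, (n j i : ℤ) ∣ (w i - v j i)}
                 {w : Fin d → ℤ | ∀ i, (n j' i : ℤ) ∣ (w i - v j' i)}) ∧
      (⋃ j, {w : Fin d → ℤ | ∀ i, (n j i : ℤ) ∣ (w i - v j i)}) = Set.univ := by
  classical
  rintro ⟨k, hk, v, n, hpos, hdist, hdisj, hcov⟩
  have hinj : ∀ j j', n j = n j' → j = j' := by
    intro j j' h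
    by_contra hne
    exact hdist j j' hne (by rw [h])
  haveI : Nonempty (Fin k) := ⟨⟨0, by omega⟩⟩
  obtain ⟨J, hJ⟩ := Finite.exists_max (fun j => ∏ i, n j i)
  have hmax : ∀ j, (∀ i, n J i ∣ n j i) → j = J := by
    intro j h
    apply hinj
    by_contra hne
    obtain ⟨i, hi⟩ := Function.ne_iff.1 hne
    have hle : ∀ i, n J i ≤ n j i := fun i => Nat.le_of_dvd (hpos j i) (h i)
    have : ∏ i, n J i < ∏ i, n j i :=
      Finset.prod_lt_prod (fun i _ => hpos J i) (fun i _ => hle i)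
        ⟨i, Finset.mem_univ _, lt_of_le_of_ne (hle i) (Ne.symm hi)⟩
    exact absurd (hJ j) (not_le.2 this)
  have hI : ∃ i, n J i ≠ 1 := by
    by_contra hcon
    push Not at hcon
    have h0 := hmax ⟨0, by omega⟩ (fun i => by rw [hcon i]; exact one_dvd _)
    have h1 := hmax ⟨1, by omega⟩ (fun i => by rw [hcon i]; exact one_dvd _)
    have := h0.trans h1.symm
    simp at this
  obtain ⟨I, hI⟩ := hI
  set N : ℕ := ∏ j, ∏ i, n j i with hNdef
  have hN : 0 < N := Finset.prod_pos fun j _ => Finset.prod_pos fun i _ => hpos j i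
  have hdvd : ∀ j i, n j i ∣ N := fun j i =>
    (Finset.dvd_prod_of_mem (n j) (Finset.mem_univ i)).trans
      (Finset.dvd_prod_of_mem (fun j => ∏ i, n j i) (Finset.mem_univ j))
  have hz : ∀ i, ∃ z : ℂ, IsPrimitiveRoot z (n J i) := fun i =>
    ⟨_, Complex.isPrimitiveRoot_exp _ (hpos J i).ne'⟩
  choose z hz using hz
  have key : ∀ w : Fin d → ℕ, ∑ j, ∏ i, cosetTerm (z i) (n j i) (v j i) (w i : ℤ)
      = ∏ i, cosetTerm (z i) 1 0 (w i : ℤ) := by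
    intro w
    have hw : (fun i => (w i : ℤ)) ∈
        ⋃ j, {w : Fin d → ℤ | ∀ i, (n j i : ℤ) ∣ (w i - v j i)} := by
      rw [hcov]; trivial
    obtain ⟨j, hj⟩ := Set.mem_iUnion.1 hw
    rw [Finset.sum_eq_single j]
    · refine Finset.prod_congr rfl fun i _ => ?_
      have := hj i
      simp only at this
      simp [cosetTerm, this]
    · intro j' _ hne
      have hnot : ¬ ∀ i, (n j' i : ℤ) ∣ ((w i : ℤ) - v j' i) := fun h =>
        Set.disjoint_left.1 (hdisj j' j hne) h hj
      push Not at hnot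
      obtain ⟨i, hi⟩ := hnot
      exact Finset.prod_eq_zero (Finset.mem_univ i) (by simp [cosetTerm, hi])
    · intro h; exact absurd (Finset.mem_univ _) h
  have tot : ∑ j, ∏ i, ∑ x ∈ Finset.range N, cosetTerm (z i) (n j i) (v j i) (x : ℤ)
      = ∏ i, ∑ x ∈ Finset.range N, cosetTerm (z i) 1 0 (x : ℤ) := by
    simp only [Finset.prod_univ_sum]
    rw [Finset.sum_comm]
    exact Finset.sum_congr rfl fun w _ => key w
  rw [Finset.prod_eq_zero (Finset.mem_univ I) (cosetTerm_sum_zero N (n J I) 1 0 (z I) (hz I)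
    (hpos J I) (hdvd J I) (one_dvd _) (by simpa using hI))] at tot
  rw [Finset.sum_eq_single J] at tot
  · exact Finset.prod_ne_zero_iff.2 (fun i _ => cosetTerm_sum_ne_zero N (n J i) (v J i) (z i)
      (hz i) (hpos J i) (hdvd J i) hN) tot
  · intro j _ hne
    have : ¬ ∀ i, n J i ∣ n j i := fun h => hne (hmax j h)
    push Not at this
    obtain ⟨i, hi⟩ := this
    exact Finset.prod_eq_zero (Finset.mem_univ i) (cosetTerm_sum_zero N (n J i) (n j i) (v j i)
      (z i) (hz i) (hpos J i) (hdvd J i) (hdvd j i) hi)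
  · intro h; exact absurd (Finset.mem_univ _) h
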